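/- Let c>0, fix an integer n≥1, and define the phase shift α_n(x,t) = 2c(x−4c²t) + (2n−1/2)·log t − (τ*(f(ξ))·(z(t,ξ)−2n+1))/4 with ξ=x/(12t) and v=1−x/(4c²t). Fix 0<δ<γ. Then uniformly for 4c²t−γ·log t < x < 4c²t−δ·log t as t→∞, α_n(x,t) = −(2n−1/2)·log(log(1/v)/(v·t)) − 8c³·t·v/log(1/v) − (6n−7/2)·log 2 + O(log²(log(1/v))/log v); moreover α_n(x,t) is bounded on this region. -/

import Mathlib

/-- `μ²(d) = (∫₀^d y²·√((d²−y²)/(c²−y²)) dy)/(∫₀^d √((d²−y²)/(c²−y²)) dy)`. -/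
noncomputable def mu2 (c d : ℝ) : ℝ :=
  (∫ y in (0:ℝ)..d, y^2 * Real.sqrt ((d^2 - y^2) / (c^2 - y^2))) /
    (∫ y in (0:ℝ)..d, Real.sqrt ((d^2 - y^2) / (c^2 - y^2)))

/-- `B_g(d) = 24·∫_d^c (y²−μ²(d))·√(y²−d²)/√(c²−y²) dy`. -/
noncomputable def Bg (c d : ℝ) : ℝ :=
  24 * ∫ y in d..c, (y^2 - mu2 c d) * Real.sqrt (y^2 - d^2) / Real.sqrt (c^2 - y^2)

/-- `I₁(d) = ∫₀^d dy/√((c²−y²)(d²−y²))`. -/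
noncomputable def I1 (c d : ℝ) : ℝ :=
  ∫ y in (0:ℝ)..d, 1 / Real.sqrt ((c^2 - y^2) * (d^2 - y^2))

/-- `I₂(d) = ∫_d^c log(c/(2√(c²−y²)))·dy/√((c²−y²)(y²−d²))`. -/
noncomputable def I2 (c d : ℝ) : ℝ :=
  ∫ y in d..c, Real.log (c / (2 * Real.sqrt (c^2 - y^2))) /
    Real.sqrt ((c^2 - y^2) * (y^2 - d^2))

/-- `Δ(d) = −I₂(d)/I₁(d)`. -/
noncomputable def Delta (c d : ℝ) : ℝ := -(I2 c d) / I1 c d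

/-- The phase variable `z(t,ξ) = (t·B_g(f(ξ)) + Δ(f(ξ)))/π`. -/
noncomputable def zvar (c : ℝ) (f : ℝ → ℝ) (t ξ : ℝ) : ℝ :=
  (t * Bg c (f ξ) + Delta c (f ξ)) / Real.pi

/-- `I₀(d) = ∫_d^c dy/√((c²−y²)(y²−d²))`. -/
noncomputable def I0 (c d : ℝ) : ℝ :=
  ∫ y in d..c, 1 / Real.sqrt ((c^2 - y^2) * (y^2 - d^2))

/-- `τ*(d) = −4π·I₁(d)/I₀(d)`. -/
noncomputable def tauStar (c d : ℝ) : ℝ := -4 * Real.pi * I1 c d / I0 c d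

/-- The phase shift `α_n(x,t)`, defined through
`τ*(f(ξ))·(z(t,ξ)−2n+1)/4 = 2c(x−4c²t)+(2n−1/2)·log t − α_n(x,t)` with `ξ = x/(12t)`. -/
noncomputable def alphan (c : ℝ) (f : ℝ → ℝ) (n : ℕ) (x t : ℝ) : ℝ :=
  2*c*(x - 4*c^2*t) + (2*n - 1/2) * Real.log t -
    tauStar c (f (x/(12*t))) * (zvar c f t (x/(12*t)) - 2*n + 1) / 4

open Real Set MeasureTheory intervalIntegral in
lemma aux_subst (φ φ' : ℝ → ℝ) (a b : ℝ) (hab : a ≤ b) (hc : ContinuousOn φ (Icc a b))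
    (hm : StrictMonoOn φ (Icc a b)) (hd : ∀ x ∈ Ioo a b, HasDerivAt φ (φ' x) x)
    (hp : ∀ x ∈ Ioo a b, 0 ≤ φ' x) (g h : ℝ → ℝ)
    (hg : ∀ x ∈ Ioo a b, φ' x * g (φ x) = h x) :
    ∫ y in (φ a)..(φ b), g y = ∫ x in a..b, h x := by
  have hle : φ a ≤ φ b := hm.monotoneOn (left_mem_Icc.2 hab) (right_mem_Icc.2 hab) hab
  have himg : φ '' Ioo a b = Ioo (φ a) (φ b) := by
    apply Subset.antisymm
    · rintro _ ⟨x, hx, rfl⟩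
      exact ⟨hm (left_mem_Icc.2 hab) (Ioo_subset_Icc_self hx) hx.1,
        hm (Ioo_subset_Icc_self hx) (right_mem_Icc.2 hab) hx.2⟩
    · exact intermediate_value_Ioo hab hc
  rw [integral_of_le hle, integral_of_le hab, integral_Ioc_eq_integral_Ioo,
    integral_Ioc_eq_integral_Ioo, ← himg,
    integral_image_eq_integral_abs_deriv_smul measurableSet_Ioo
      (fun x hx => (hd x hx).hasDerivWithinAt) (hm.injOn.mono Ioo_subset_Icc_self)]
  apply setIntegral_congr_fun measurableSet_Ioo
  intro x hx
  simp only [smul_eq_mul, abs_of_nonneg (hp x hx), hg x hx]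

open Real Set MeasureTheory intervalIntegral in
lemma aux_subst_sin (d : ℝ) (hd : 0 < d) (g h : ℝ → ℝ)
    (hg : ∀ x ∈ Ioo 0 (π/2), d * cos x * g (d * sin x) = h x) :
    ∫ y in (0:ℝ)..d, g y = ∫ x in (0:ℝ)..(π/2), h x := by
  have := aux_subst (fun x => d * sin x) (fun x => d * cos x) 0 (π/2) (by positivity)
    (by fun_prop) ?_ ?_ ?_ g h hg
  · simpa using this
  · intro x hx y hy hxy
    have := strictMonoOn_sin (a := x) (b := y) ⟨by linarith [hx.1, pi_pos], hx.2⟩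
      ⟨by linarith [hy.1, pi_pos], hy.2⟩ hxy
    simp only
    gcongr
  · intro x _
    exact (hasDerivAt_sin x).const_mul d
  · intro x hx
    have : 0 < cos x := cos_pos_of_mem_Ioo ⟨by linarith [hx.1, pi_pos], hx.2⟩
    positivity

open Real Set MeasureTheory intervalIntegral in
lemma aux_subst_phi (c d : ℝ) (hd : 0 < d) (hdc : d < c) (g h : ℝ → ℝ)
    (hg : ∀ x ∈ Ioo 0 (π/2), ((c^2-d^2) * sin x * cos x / √(d^2 + (c^2-d^2) * sin x^2)) *
      g (√(d^2 + (c^2-d^2) * sin x^2)) = h x) :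
    ∫ y in d..c, g y = ∫ x in (0:ℝ)..(π/2), h x := by
  have hcd : 0 < c^2 - d^2 := by nlinarith
  have hpos : ∀ x, 0 < d^2 + (c^2-d^2) * sin x^2 := fun x => by positivity
  have := aux_subst (fun x => √(d^2 + (c^2-d^2) * sin x^2))
    (fun x => (c^2-d^2) * sin x * cos x / √(d^2 + (c^2-d^2) * sin x^2)) 0 (π/2) (by positivity)
    (by fun_prop) ?_ ?_ ?_ g h hg
  · simp only [sin_zero, sin_pi_div_two] at this
    rw [show d^2 + (c^2-d^2) * 0^2 = d^2 by ring, show d^2 + (c^2-d^2) * 1^2 = c^2 by ring,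
      sqrt_sq hd.le, sqrt_sq (hd.trans hdc).le] at this
    exact this
  · intro x hx y hy hxy
    have h1 := strictMonoOn_sin (a := x) (b := y) ⟨by linarith [hx.1, pi_pos], hx.2⟩
      ⟨by linarith [hy.1, pi_pos], hy.2⟩ hxy
    have h0 : 0 ≤ sin x := sin_nonneg_of_nonneg_of_le_pi hx.1 (by linarith [hx.2, pi_pos])
    apply sqrt_lt_sqrt (hpos x).le
    gcongr
  · intro x _
    have h0 : HasDerivAt (fun y => sin y ^ 2) (2 * sin x * cos x) x := by
      simpa using (hasDerivAt_sin x).fun_pow 2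
    have h1 := ((h0.const_mul (c^2-d^2)).const_add (d^2)).sqrt (hpos x).ne'
    convert h1 using 1
    have := sqrt_pos.2 (hpos x)
    field_simp
  · intro x hx
    have : 0 < cos x := cos_pos_of_mem_Ioo ⟨by linarith [hx.1, pi_pos], hx.2⟩
    have h0 : 0 < sin x := sin_pos_of_pos_of_lt_pi hx.1 (by linarith [hx.2, pi_pos])
    positivity

noncomputable def WW (k θ : ℝ) : ℝ := √(1 - k^2 * Real.sin θ ^ 2)
noncomputable def KK (k : ℝ) : ℝ := ∫ θ in (0:ℝ)..(Real.pi/2), 1 / WW k θ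
noncomputable def EE (k : ℝ) : ℝ := ∫ θ in (0:ℝ)..(Real.pi/2), WW k θ

open Real

lemma WW_arg_pos (k θ : ℝ) (hk0 : 0 < k) (hk : k < 1) : 0 < 1 - k^2 * sin θ ^ 2 := by
  have h1 : sin θ ^ 2 ≤ 1 := sin_sq_le_one θ
  have h2 : k^2 < 1 := by nlinarith
  nlinarith [sq_nonneg (sin θ), sq_nonneg k]

lemma WW_pos (k θ : ℝ) (hk0 : 0 < k) (hk : k < 1) : 0 < WW k θ :=
  sqrt_pos.2 (WW_arg_pos k θ hk0 hk)

lemma WW_sq (k θ : ℝ) (hk0 : 0 < k) (hk : k < 1) : WW k θ ^ 2 = 1 - k^2 * sin θ ^ 2 :=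
  sq_sqrt (WW_arg_pos k θ hk0 hk).le

lemma WW_cont (k : ℝ) : Continuous (WW k) := by
  unfold WW; fun_prop

lemma WW_inv_cont (k : ℝ) (hk0 : 0 < k) (hk : k < 1) (g : ℝ → ℝ) (hg : Continuous g) :
    Continuous (fun θ => g θ / WW k θ) :=
  hg.div (WW_cont k) (fun θ => (WW_pos k θ hk0 hk).ne')

lemma I1_eq (c d : ℝ) (hd : 0 < d) (hdc : d < c) : I1 c d = KK (d/c) / c := by
  have hc : 0 < c := hd.trans hdc
  have hk0 : 0 < d/c := by positivity
  have hk : d/c < 1 := (div_lt_one hc).2 hdc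
  unfold I1 KK
  rw [← intervalIntegral.integral_div]
  apply aux_subst_sin d hd
  intro x hx
  have hcos : 0 < cos x := cos_pos_of_mem_Ioo ⟨by linarith [hx.1, pi_pos], hx.2⟩
  have hW := WW_pos (d/c) x hk0 hk
  have hW2 := WW_sq (d/c) x hk0 hk
  have : (c^2 - (d * sin x)^2) * (d^2 - (d*sin x)^2) = (c * WW (d/c) x * (d * cos x))^2 := by
    rw [mul_pow (c * _), mul_pow c, hW2, mul_pow d (cos x), cos_sq']
    field_simp
  rw [this, sqrt_sq (by positivity)]
  field_simp

lemma mu2_eq (c d : ℝ) (hd : 0 < d) (hdc : d < c) :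
    0 < EE (d/c) - (1-(d/c)^2) * KK (d/c) ∧
    3 * mu2 c d * (EE (d/c) - (1-(d/c)^2) * KK (d/c)) = c^2 *
      ((EE (d/c) - (1-(d/c)^2) * KK (d/c)) - (1-(d/c)^2) * (KK (d/c) - EE (d/c))) := by
  have hc : 0 < c := hd.trans hdc
  set k := d/c with hkdef
  have hk0 : 0 < k := by positivity
  have hk : k < 1 := (div_lt_one hc).2 hdc
  have hdk : d = c * k := by rw [hkdef]; field_simp
  have key : ∀ x ∈ Set.Ioo 0 (π/2), √((d^2 - (d*sin x)^2) / (c^2 - (d*sin x)^2)) =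
      k * cos x / WW k x := by
    intro x hx
    have hcos : 0 < cos x := cos_pos_of_mem_Ioo ⟨by linarith [hx.1, pi_pos], hx.2⟩
    have hW := WW_pos k x hk0 hk
    have hW2 := WW_sq k x hk0 hk
    have : (d^2 - (d*sin x)^2) / (c^2 - (d*sin x)^2) = (k * cos x / WW k x)^2 := by
      rw [div_pow, hW2, mul_pow k, cos_sq', hdk]
      have := WW_arg_pos k x hk0 hk
      rw [show c^2 - (c*k*sin x)^2 = c^2 * (1 - k^2 * sin x^2) by ring]
      field_simp
    rw [this, sqrt_sq (by positivity)]
  have hD : ∫ y in (0:ℝ)..d, √((d^2 - y^2) / (c^2 - y^2)) =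
      ∫ x in (0:ℝ)..(π/2), c * (k^2 * cos x^2 / WW k x) := by
    apply aux_subst_sin d hd
    intro x hx
    simp only [key x hx]
    rw [hdk]; ring
  have hN : ∫ y in (0:ℝ)..d, y^2 * √((d^2 - y^2) / (c^2 - y^2)) =
      ∫ x in (0:ℝ)..(π/2), c^3 * (k^4 * sin x^2 * cos x^2 / WW k x) := by
    apply aux_subst_sin d hd
    intro x hx
    simp only [key x hx]
    rw [hdk]; ring
  have iK : IntervalIntegrable (fun θ => 1 / WW k θ) MeasureTheory.volume 0 (π/2) :=
    (WW_inv_cont k hk0 hk _ continuous_const).intervalIntegrable _ _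
  have iE : IntervalIntegrable (fun θ => WW k θ) MeasureTheory.volume 0 (π/2) :=
    (WW_cont k).intervalIntegrable _ _
  have iN : IntervalIntegrable (fun x => k^4 * sin x^2 * cos x^2 / WW k x)
      MeasureTheory.volume 0 (π/2) :=
    (WW_inv_cont k hk0 hk _ (by fun_prop)).intervalIntegrable _ _
  have hD' : ∫ x in (0:ℝ)..(π/2), k^2 * cos x^2 / WW k x = EE k - (1-k^2) * KK k := by
    unfold EE KK
    rw [← intervalIntegral.integral_const_mul, ← intervalIntegral.integral_sub iE (iK.const_mul _)]
    apply intervalIntegral.integral_congr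
    intro x _
    have hW := WW_pos k x hk0 hk
    have hW2 := WW_sq k x hk0 hk
    simp only
    field_simp
    rw [hW2, cos_sq']; ring
  have hDpos : 0 < ∫ x in (0:ℝ)..(π/2), k^2 * cos x^2 / WW k x := by
    apply intervalIntegral.intervalIntegral_pos_of_pos_on _ _ (by positivity)
    · exact (WW_inv_cont k hk0 hk _ (by fun_prop)).intervalIntegrable _ _
    · intro x hx
      have hcos : 0 < cos x := cos_pos_of_mem_Ioo ⟨by linarith [hx.1, pi_pos], hx.2⟩
      have hW := WW_pos k x hk0 hk
      positivity
  have hF : ∫ x in (0:ℝ)..(π/2), ((cos x^2 - sin x^2) * WW k x - k^2 * sin x^2 * cos x^2 / WW k x)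
      = 0 := by
    have hder : ∀ x ∈ Set.uIcc 0 (π/2), HasDerivAt (fun x => sin x * cos x * WW k x)
        ((cos x^2 - sin x^2) * WW k x - k^2 * sin x^2 * cos x^2 / WW k x) x := by
      intro x _
      have hW := WW_pos k x hk0 hk
      have h0 : HasDerivAt (fun y => sin y ^ 2) (2 * sin x * cos x) x := by
        simpa using (hasDerivAt_sin x).fun_pow 2
      have h1 : HasDerivAt (fun y => WW k y) _ x :=
        ((h0.const_mul (k^2)).const_sub 1).sqrt (WW_arg_pos k x hk0 hk).ne'
      have h2 := ((hasDerivAt_sin x).fun_mul (hasDerivAt_cos x)).fun_mul h1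
      refine h2.congr_deriv ?_
      change _ + sin x * cos x * (-(k^2 * (2 * sin x * cos x)) / (2 * WW k x)) = _
      field_simp
      ring
    rw [intervalIntegral.integral_eq_sub_of_hasDerivAt hder]
    · simp
    · exact (((by fun_prop : Continuous (fun x => cos x^2 - sin x^2)).mul (WW_cont k)).sub
        (WW_inv_cont k hk0 hk _ (by fun_prop))).intervalIntegrable _ _
  have hN' : 3 * ∫ x in (0:ℝ)..(π/2), k^4 * sin x^2 * cos x^2 / WW k x =
      (EE k - (1-k^2) * KK k) - (1-k^2) * (KK k - EE k) := by
    have e1 : k^2 * (∫ x in (0:ℝ)..(π/2),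
        ((cos x^2 - sin x^2) * WW k x - k^2 * sin x^2 * cos x^2 / WW k x)) =
        (EE k - (1-k^2) * KK k) - (1-k^2) * (KK k - EE k) -
        3 * ∫ x in (0:ℝ)..(π/2), k^4 * sin x^2 * cos x^2 / WW k x := by
      have e2 : (EE k - (1-k^2) * KK k) - (1-k^2) * (KK k - EE k) -
        3 * ∫ x in (0:ℝ)..(π/2), k^4 * sin x^2 * cos x^2 / WW k x = (2 - k^2) * EE k
          - (2*(1-k^2)) * KK k - 3 * ∫ x in (0:ℝ)..(π/2), k^4 * sin x^2 * cos x^2 / WW k x := by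
        ring
      rw [e2]
      unfold EE KK
      rw [← intervalIntegral.integral_const_mul, ← intervalIntegral.integral_const_mul,
        ← intervalIntegral.integral_const_mul, ← intervalIntegral.integral_const_mul,
        ← intervalIntegral.integral_sub (iE.const_mul _) (iK.const_mul _),
        ← intervalIntegral.integral_sub ((iE.const_mul _).sub (iK.const_mul _)) (iN.const_mul _)]
      apply intervalIntegral.integral_congr
      intro x _
      have hW := WW_pos k x hk0 hk
      have hW2 := WW_sq k x hk0 hk
      simp only
      field_simp
      rw [hW2, cos_sq']; ring
    rw [hF] at e1
    linarith
  refine ⟨hD' ▸ hDpos, ?_⟩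
  unfold mu2
  rw [hD, hN, intervalIntegral.integral_const_mul, intervalIntegral.integral_const_mul, ← hD']
  rw [← hD'] at hN'
  rw [← hN']
  field_simp

lemma KK_sub_EE_nonneg (k : ℝ) (hk0 : 0 < k) (hk : k < 1) : 0 ≤ KK k - EE k := by
  have iK : IntervalIntegrable (fun θ => 1 / WW k θ) MeasureTheory.volume 0 (π/2) :=
    (WW_inv_cont k hk0 hk _ continuous_const).intervalIntegrable _ _
  have iE : IntervalIntegrable (fun θ => WW k θ) MeasureTheory.volume 0 (π/2) :=
    (WW_cont k).intervalIntegrable _ _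
  rw [sub_nonneg]
  apply intervalIntegral.integral_mono_on (by positivity) iE iK
  intro x _
  have hW := WW_pos k x hk0 hk
  have hW2 := WW_sq k x hk0 hk
  rw [le_div_iff₀ hW]
  nlinarith [sq_nonneg (k * sin x)]

lemma WW_ge_cos (k x : ℝ) (hk0 : 0 < k) (hk : k < 1) : cos x ≤ WW k x := by
  apply le_sqrt_of_sq_le
  rw [cos_sq']
  have h2 : k^2 < 1 := by nlinarith
  nlinarith [sq_nonneg (sin x)]

lemma WW_le (k x : ℝ) (hk0 : 0 < k) (hk : k < 1) (hx : 0 ≤ cos x) :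
    WW k x ≤ cos x + √(1-k^2) := by
  have h2 : 0 < 1 - k^2 := by nlinarith
  apply sqrt_le_iff.2 ⟨by positivity, ?_⟩
  have h3 := sq_sqrt h2.le
  have h4 : 0 ≤ cos x * √(1-k^2) := by positivity
  have h5 := cos_sq' x
  nlinarith [sin_sq_le_one x]

lemma EE_bd (k : ℝ) (hk0 : 0 < k) (hk : k < 1) : |EE k - 1| ≤ 2 * √(1-k^2) := by
  have iE : IntervalIntegrable (fun θ => WW k θ) MeasureTheory.volume 0 (π/2) :=
    (WW_cont k).intervalIntegrable _ _
  have hcos : ∫ x in (0:ℝ)..(π/2), cos x = 1 := by simp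
  have h1 : 1 ≤ EE k := by
    rw [← hcos]
    apply intervalIntegral.integral_mono_on (by positivity)
      (continuous_cos.intervalIntegrable _ _) iE
    intro x _
    exact WW_ge_cos k x hk0 hk
  have h2 : EE k ≤ ∫ x in (0:ℝ)..(π/2), (cos x + √(1-k^2)) := by
    apply intervalIntegral.integral_mono_on (by positivity) iE
      (Continuous.intervalIntegrable (by fun_prop) _ _)
    intro x hx
    exact WW_le k x hk0 hk (cos_nonneg_of_mem_Icc ⟨by linarith [hx.1, pi_pos], hx.2⟩)
  rw [intervalIntegral.integral_add (continuous_cos.intervalIntegrable _ _)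
    (continuous_const.intervalIntegrable _ _), hcos, intervalIntegral.integral_const] at h2
  simp only [smul_eq_mul, sub_zero] at h2
  rw [abs_of_nonneg (by linarith)]
  have := pi_le_four
  nlinarith [sqrt_nonneg (1-k^2)]

lemma KK_part1 (k : ℝ) (hk0 : 0 < k) (hk : k < 1) :
    ∫ x in (0:ℝ)..(π/2), sin x / WW k x = (1/k) * log ((1+k)/√(1-k^2)) := by
  have h2 : 0 < 1 - k^2 := by nlinarith
  have hε := sqrt_pos.2 h2
  have hε2 := sq_sqrt h2.le
  set ε := √(1-k^2) with hεdef
  have hder : ∀ x ∈ Set.uIcc 0 (π/2), HasDerivAt (fun x => -(1/k) * arsinh (k/ε * cos x))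
        (sin x / WW k x) x := by
    intro x _
    have h1 := (((hasDerivAt_cos x).const_mul (k/ε)).arsinh).const_mul (-(1/k))
    refine h1.congr_deriv ?_
    have : 1 + (k/ε * cos x)^2 = (WW k x/ε)^2 := by
      rw [div_pow, WW_sq k x hk0 hk, mul_pow, div_pow, hε2, cos_sq']
      field_simp
      ring
    rw [this, sqrt_sq (div_nonneg (WW_pos k x hk0 hk).le hε.le)]
    have hW := WW_pos k x hk0 hk
    simp only [smul_eq_mul]
    field_simp
  rw [intervalIntegral.integral_eq_sub_of_hasDerivAt hder
    ((WW_inv_cont k hk0 hk _ (by fun_prop)).intervalIntegrable _ _)]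
  simp only [cos_pi_div_two, cos_zero, mul_zero, arsinh_zero, mul_one]
  unfold arsinh
  have : 1 + (k/ε)^2 = (1/ε)^2 := by
    rw [div_pow, div_pow, hε2]; field_simp; ring
  rw [this, sqrt_sq (by positivity), ← add_div, add_comm k 1]
  ring

lemma KK_part2 (k : ℝ) (hk0 : 0 < k) (hk : k < 1) :
    |(∫ x in (0:ℝ)..(π/2), (1 - sin x) / WW k x) - log 2| ≤ 2 * √(1-k^2) := by
  have h2 : 0 < 1 - k^2 := by nlinarith
  have hε := sqrt_pos.2 h2
  set ε := √(1-k^2) with hεdef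
  have hs : ∀ x ∈ Set.Icc 0 (π/2), 0 ≤ sin x := fun x hx =>
    sin_nonneg_of_nonneg_of_le_pi hx.1 (by linarith [hx.2, pi_pos])
  have hci : IntervalIntegrable (fun x => cos x / (1 + sin x)) MeasureTheory.volume 0 (π/2) := by
    apply ContinuousOn.intervalIntegrable
    rw [Set.uIcc_of_le (by positivity)]
    apply ContinuousOn.div (by fun_prop) (by fun_prop)
    intro x hx
    linarith [hs x hx]
  have hlog : ∫ x in (0:ℝ)..(π/2), cos x / (1 + sin x) = log 2 := by
    have hder : ∀ x ∈ Set.uIcc 0 (π/2), HasDerivAt (fun x => log (1 + sin x))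
        (cos x / (1 + sin x)) x := by
      intro x hx
      rw [Set.uIcc_of_le (by positivity)] at hx
      exact ((hasDerivAt_sin x).const_add 1).log (by linarith [hs x hx])
    rw [intervalIntegral.integral_eq_sub_of_hasDerivAt hder hci]
    norm_num
  have iW : IntervalIntegrable (fun x => (1 - sin x) / WW k x) MeasureTheory.volume 0 (π/2) :=
    (WW_inv_cont k hk0 hk _ (by fun_prop)).intervalIntegrable _ _
  have u : ∫ x in (0:ℝ)..(π/2), (1 - sin x) / WW k x ≤ log 2 := by
    rw [← hlog]
    apply intervalIntegral.integral_mono_on (by positivity) iW hci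
    intro x hx
    have hW := WW_pos k x hk0 hk
    have h0 := hs x hx
    rw [div_le_div_iff₀ hW (by linarith)]
    have hcx : 0 ≤ cos x := cos_nonneg_of_mem_Icc ⟨by linarith [hx.1, pi_pos], hx.2⟩
    have h5 := cos_sq' x
    nlinarith [WW_ge_cos k x hk0 hk]
  have l : log 2 - ∫ x in (0:ℝ)..(π/2), (1 - sin x) / WW k x ≤ ∫ x in (0:ℝ)..(π/2), ε := by
    rw [← hlog, ← intervalIntegral.integral_sub hci iW]
    apply intervalIntegral.integral_mono_on (by positivity) (hci.sub iW)
      (continuous_const.intervalIntegrable _ _)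
    intro x hx
    have hW := WW_pos k x hk0 hk
    have h0 := hs x hx
    have hcx : 0 ≤ cos x := cos_nonneg_of_mem_Icc ⟨by linarith [hx.1, pi_pos], hx.2⟩
    have h5 := cos_sq' x
    rw [div_sub_div _ _ (by linarith) hW.ne', div_le_iff₀ (by positivity)]
    have h6 := WW_le k x hk0 hk hcx
    have h7 := WW_ge_cos k x hk0 hk
    have h8 : (1 + sin x) * (1 - sin x) = cos x^2 := by rw [h5]; ring
    rw [h8]
    have : cos x * WW k x - cos x^2 ≤ cos x * ε := by nlinarith
    have : cos x * ε ≤ WW k x * ε := by gcongr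
    have : 0 ≤ ε * sin x * WW k x := by positivity
    nlinarith
  rw [intervalIntegral.integral_const] at l
  simp only [smul_eq_mul, sub_zero] at l
  rw [abs_le]
  have := pi_le_four
  constructor <;> nlinarith

lemma KK_bd (k : ℝ) (hk0 : 1/2 ≤ k) (hk : k < 1) :
    |KK k - log (4/√(1-k^2))| ≤ 8 * √(1-k^2) := by
  have hk0' : 0 < k := by linarith
  have h2 : 0 < 1 - k^2 := by nlinarith
  have hε := sqrt_pos.2 h2
  have hε2 := sq_sqrt h2.le
  have p1 := KK_part1 k hk0' hk
  have p2 := KK_part2 k hk0' hk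
  have hsum : KK k = (∫ x in (0:ℝ)..(π/2), sin x / WW k x) +
      ∫ x in (0:ℝ)..(π/2), (1 - sin x) / WW k x := by
    unfold KK
    rw [← intervalIntegral.integral_add
      ((WW_inv_cont k hk0' hk _ (by fun_prop)).intervalIntegrable _ _)
      ((WW_inv_cont k hk0' hk _ (by fun_prop)).intervalIntegrable _ _)]
    congr 1; ext x; ring
  rw [p1] at hsum
  set ε := √(1-k^2) with hεdef
  have hε1 : ε < 1 := by nlinarith
  have h1k : 1 - k ≤ ε^2 := by nlinarith
  have e4 : log (4/ε) = log (2/ε) + log 2 := by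
    rw [← log_mul (by positivity) (by norm_num)]; congr 1; ring
  have e5 : log ((1+k)/ε) ≤ log (2/ε) := log_le_log (by positivity) (by gcongr; linarith)
  have e6 : log (2/ε) ≤ 2/ε := (log_le_sub_one_of_pos (by positivity)).trans (by linarith)
  have e7 : log (2/ε) - ε^2 ≤ log ((1+k)/ε) := by
    have : log ((1+k)/ε) = log (2/ε) + log ((1+k)/2) := by
      rw [← log_mul (by positivity) (by positivity)]; congr 1; field_simp
    have h3 := one_sub_inv_le_log_of_pos (show 0 < (1+k)/2 by linarith)
    have : ((1+k)/2)⁻¹ ≤ 1 + (1-k) := by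
      rw [inv_le_iff_one_le_mul₀ (by linarith)]
      nlinarith
    linarith
  have e8 : 0 ≤ log ((1+k)/ε) := log_nonneg (by rw [le_div_iff₀ hε]; linarith)
  have e9 : (1/k) * log ((1+k)/ε) ≤ log (2/ε) + 4 * ε := by
    have : (1/k) ≤ 1 + 2 * ε^2 := by
      rw [div_le_iff₀ hk0']; nlinarith
    have h3 : 0 ≤ log (2/ε) := e8.trans e5
    calc (1/k) * log ((1+k)/ε) ≤ (1 + 2*ε^2) * log (2/ε) := by gcongr
      _ = log (2/ε) + 2*ε^2*log (2/ε) := by ring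
      _ ≤ log (2/ε) + 2*ε^2*(2/ε) := by gcongr
      _ = _ := by field_simp; ring
  have e10 : log ((1+k)/ε) ≤ (1/k) * log ((1+k)/ε) := by
    apply le_mul_of_one_le_left e8
    rw [le_div_iff₀ hk0']; linarith
  rw [abs_le] at p2 ⊢
  constructor <;> nlinarith

noncomputable def Ph (k θ : ℝ) : ℝ := √(k^2 + (1-k^2) * sin θ ^ 2)

lemma Ph_ge (k θ : ℝ) (hk0 : 0 < k) (hk : k < 1) : k ≤ Ph k θ := by
  have h2 : 0 < 1 - k^2 := by nlinarith
  apply le_sqrt_of_sq_le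
  have : 0 ≤ (1-k^2) * sin θ ^ 2 := by positivity
  linarith

lemma Ph_le (k θ : ℝ) (hk0 : 0 < k) (hk : k < 1) : Ph k θ ≤ 1 := by
  have h2 : 0 < 1 - k^2 := by nlinarith
  apply sqrt_le_iff.2 ⟨by norm_num, ?_⟩
  nlinarith [sin_sq_le_one θ]

lemma Ph_sq (k θ : ℝ) (hk0 : 0 < k) (hk : k < 1) : Ph k θ ^ 2 = k^2 + (1-k^2) * sin θ ^ 2 := by
  have h2 : 0 < 1 - k^2 := by nlinarith
  exact sq_sqrt (by positivity)

lemma Ph_cont (k : ℝ) : Continuous (Ph k) := by unfold Ph; fun_prop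

lemma phi_eq (c d x : ℝ) (hd : 0 < d) (hdc : d < c) :
    √(d^2 + (c^2-d^2) * sin x^2) = c * Ph (d/c) x := by
  have hc : 0 < c := hd.trans hdc
  unfold Ph
  rw [← sqrt_sq hc.le, ← sqrt_mul (sq_nonneg _), sqrt_sq hc.le]
  congr 1
  field_simp

noncomputable def J0 (k : ℝ) : ℝ := ∫ θ in (0:ℝ)..(π/2), 1 / Ph k θ
noncomputable def J2 (k : ℝ) : ℝ :=
  ∫ θ in (0:ℝ)..(π/2), log (1 / (2 * √(1-k^2) * cos θ)) / Ph k θ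

lemma prod_eq (c d x : ℝ) (hd : 0 < d) (hdc : d < c) (hx : x ∈ Set.Ioo 0 (π/2)) :
    √(c^2 - (c * Ph (d/c) x)^2) = c * √(1-(d/c)^2) * cos x ∧
    √((c * Ph (d/c) x)^2 - d^2) = c * √(1-(d/c)^2) * sin x ∧
    √((c^2 - (c * Ph (d/c) x)^2) * ((c * Ph (d/c) x)^2 - d^2)) =
      (c^2-d^2) * sin x * cos x := by
  have hc : 0 < c := hd.trans hdc
  have hk0 : 0 < d/c := by positivity
  have hk : d/c < 1 := (div_lt_one hc).2 hdc
  have hm : 0 < 1 - (d/c)^2 := by nlinarith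
  have hcos : 0 < cos x := cos_pos_of_mem_Ioo ⟨by linarith [hx.1, pi_pos], hx.2⟩
  have hsin : 0 < sin x := sin_pos_of_pos_of_lt_pi hx.1 (by linarith [hx.2, pi_pos])
  have e1 : c^2 - (c * Ph (d/c) x)^2 = (c * √(1-(d/c)^2) * cos x)^2 := by
    rw [mul_pow, Ph_sq _ _ hk0 hk, mul_pow (c * _), mul_pow c, sq_sqrt hm.le, cos_sq']
    ring
  have e2 : (c * Ph (d/c) x)^2 - d^2 = (c * √(1-(d/c)^2) * sin x)^2 := by
    rw [mul_pow, Ph_sq _ _ hk0 hk, mul_pow (c * _), mul_pow c, sq_sqrt hm.le]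
    field_simp
    ring
  have e3 : c * √(1-(d/c)^2) * cos x * (c * √(1-(d/c)^2) * sin x) = (c^2-d^2) * sin x * cos x := by
    have : c * √(1-(d/c)^2) * cos x * (c * √(1-(d/c)^2) * sin x) =
      c^2 * (√(1-(d/c)^2))^2 * sin x * cos x := by ring
    rw [this, sq_sqrt hm.le]
    field_simp
  refine ⟨?_, ?_, ?_⟩
  · rw [e1, sqrt_sq (by positivity)]
  · rw [e2, sqrt_sq (by positivity)]
  · rw [e1, e2, ← mul_pow, sqrt_sq (by positivity), e3]

lemma I0_eq (c d : ℝ) (hd : 0 < d) (hdc : d < c) : I0 c d = J0 (d/c) / c := by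
  have hc : 0 < c := hd.trans hdc
  have hk0 : 0 < d/c := by positivity
  have hk : d/c < 1 := (div_lt_one hc).2 hdc
  have hm : 0 < c^2 - d^2 := by nlinarith
  unfold I0 J0
  rw [← intervalIntegral.integral_div]
  apply aux_subst_phi c d hd hdc
  intro x hx
  obtain ⟨h1, h2, h3⟩ := prod_eq c d x hd hdc hx
  have hcos : 0 < cos x := cos_pos_of_mem_Ioo ⟨by linarith [hx.1, pi_pos], hx.2⟩
  have hsin : 0 < sin x := sin_pos_of_pos_of_lt_pi hx.1 (by linarith [hx.2, pi_pos])
  have hP := hk0.trans_le (Ph_ge (d/c) x hk0 hk)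
  rw [phi_eq c d x hd hdc, h3]
  field_simp

lemma I2_eq (c d : ℝ) (hd : 0 < d) (hdc : d < c) : I2 c d = J2 (d/c) / c := by
  have hc : 0 < c := hd.trans hdc
  have hk0 : 0 < d/c := by positivity
  have hk : d/c < 1 := (div_lt_one hc).2 hdc
  have hm : 0 < c^2 - d^2 := by nlinarith
  have hm' : 0 < 1 - (d/c)^2 := by nlinarith
  unfold I2 J2
  rw [← intervalIntegral.integral_div]
  apply aux_subst_phi c d hd hdc
  intro x hx
  obtain ⟨h1, h2, h3⟩ := prod_eq c d x hd hdc hx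
  have hcos : 0 < cos x := cos_pos_of_mem_Ioo ⟨by linarith [hx.1, pi_pos], hx.2⟩
  have hsin : 0 < sin x := sin_pos_of_pos_of_lt_pi hx.1 (by linarith [hx.2, pi_pos])
  have hP := hk0.trans_le (Ph_ge (d/c) x hk0 hk)
  have hε := sqrt_pos.2 hm'
  rw [phi_eq c d x hd hdc, h3, h1]
  rw [show c / (2 * (c * √(1-(d/c)^2) * cos x)) = 1 / (2 * √(1-(d/c)^2) * cos x) by field_simp]
  generalize log _ = Y
  field_simp

lemma Bg_eq (c d : ℝ) (hd : 0 < d) (hdc : d < c) : Bg c d =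
    24 * c^3 * (1-(d/c)^2) * ∫ x in (0:ℝ)..(π/2), (Ph (d/c) x - (mu2 c d/c^2) / Ph (d/c) x)
      * sin x^2 := by
  have hc : 0 < c := hd.trans hdc
  have hk0 : 0 < d/c := by positivity
  have hk : d/c < 1 := (div_lt_one hc).2 hdc
  have hm : 0 < c^2 - d^2 := by nlinarith
  have hm' : 0 < 1 - (d/c)^2 := by nlinarith
  unfold Bg
  rw [mul_assoc, mul_assoc, ← mul_assoc (c^3)]
  congr 1
  rw [← intervalIntegral.integral_const_mul]
  apply aux_subst_phi c d hd hdc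
  intro x hx
  obtain ⟨h1, h2, h3⟩ := prod_eq c d x hd hdc hx
  have hcos : 0 < cos x := cos_pos_of_mem_Ioo ⟨by linarith [hx.1, pi_pos], hx.2⟩
  have hsin : 0 < sin x := sin_pos_of_pos_of_lt_pi hx.1 (by linarith [hx.2, pi_pos])
  have hP := hk0.trans_le (Ph_ge (d/c) x hk0 hk)
  have hε := sqrt_pos.2 hm'
  rw [phi_eq c d x hd hdc, h2, h1]
  field_simp

lemma inv_k_le (k : ℝ) (hk0 : 1/2 ≤ k) (hk : k < 1) : 1/k ≤ 1 + 2 * (1-k^2) := by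
  rw [div_le_iff₀ (by linarith)]
  nlinarith

lemma J0_bd (k : ℝ) (hk0 : 1/2 ≤ k) (hk : k < 1) :
    π/2 ≤ J0 k ∧ J0 k ≤ π/2 * (1 + 2 * (1-k^2)) := by
  have hk0' : 0 < k := by linarith
  have hP : ∀ x, 0 < Ph k x := fun x => hk0'.trans_le (Ph_ge k x hk0' hk)
  have i : IntervalIntegrable (fun x => 1 / Ph k x) MeasureTheory.volume 0 (π/2) :=
    (continuous_const.div (Ph_cont k) (fun x => (hP x).ne')).intervalIntegrable _ _
  constructor
  · have : ∫ x in (0:ℝ)..(π/2), (1:ℝ) = π/2 := by simp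
    rw [← this]
    apply intervalIntegral.integral_mono_on (by positivity)
      (continuous_const.intervalIntegrable _ _) i
    intro x _
    rw [le_div_iff₀ (hP x)]
    linarith [Ph_le k x hk0' hk]
  · have : ∫ x in (0:ℝ)..(π/2), (1 + 2 * (1-k^2)) = π/2 * (1 + 2 * (1-k^2)) := by
      rw [intervalIntegral.integral_const]; simp
    rw [← this]
    apply intervalIntegral.integral_mono_on (by positivity) i
      (continuous_const.intervalIntegrable _ _)
    intro x _
    refine le_trans ?_ (inv_k_le k hk0 hk)
    gcongr
    exact Ph_ge k x hk0' hk

lemma int_log_cos : ∫ x in (0:ℝ)..(π/2), log (cos x) = -log 2 * π / 2 := by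
  rw [← integral_log_sin_zero_pi_div_two]
  have := intervalIntegral.integral_comp_sub_left (a := 0) (b := π/2)
    (fun x => log (sin x)) (π/2)
  simpa [sin_pi_div_two_sub] using this

lemma J2_bd (k : ℝ) (hk0 : 1/2 ≤ k) (hk : k < 1) (hε : √(1-k^2) ≤ 1/2) :
    |J2 k / J0 k - log (1/√(1-k^2))| ≤ 2 * √(1-k^2) := by
  have hk0' : 0 < k := by linarith
  have hP : ∀ x, 0 < Ph k x := fun x => hk0'.trans_le (Ph_ge k x hk0' hk)
  have h2 : 0 < 1 - k^2 := by nlinarith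
  have hε0 := sqrt_pos.2 h2
  have hε2 := sq_sqrt h2.le
  obtain ⟨hJ1, hJ2⟩ := J0_bd k hk0 hk
  set ε := √(1-k^2) with hεdef
  rw [← hε2] at hJ2
  have hcos : ∀ x ∈ Set.Ioo 0 (π/2), 0 < cos x := fun x hx =>
    cos_pos_of_mem_Ioo ⟨by linarith [hx.1, pi_pos], hx.2⟩
  have hlog : ∀ x ∈ Set.Ioo 0 (π/2), log (1/(2*ε*cos x)) = -log (2*ε) - log (cos x) := by
    intro x hx
    have := hcos x hx
    rw [one_div, log_inv, log_mul (by positivity) (by positivity)]; ring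
  have hnn : ∀ x ∈ Set.Ioo 0 (π/2), 0 ≤ log (1/(2*ε*cos x)) := by
    intro x hx
    have := hcos x hx
    apply log_nonneg
    rw [le_div_iff₀ (by positivity)]
    nlinarith [cos_le_one x]
  have ig0 : IntervalIntegrable (fun x => -log (2*ε) - log (cos x))
      MeasureTheory.volume 0 (π/2) :=
    (continuous_const.intervalIntegrable _ _).sub intervalIntegrable_log_cos
  have hcongr : ∀ᵐ x ∂(MeasureTheory.volume.restrict (Set.uIoc 0 (π/2))),
      -log (2*ε) - log (cos x) = log (1/(2*ε*cos x)) := by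
    rw [Set.uIoc_of_le (by positivity), MeasureTheory.Measure.restrict_congr_set
      MeasureTheory.Ioo_ae_eq_Ioc.symm]
    filter_upwards [MeasureTheory.ae_restrict_mem measurableSet_Ioo] with x hx
    exact (hlog x hx).symm
  have ig : IntervalIntegrable (fun x => log (1/(2*ε*cos x))) MeasureTheory.volume 0 (π/2) :=
    ig0.congr_ae hcongr
  have iJ : IntervalIntegrable (fun x => log (1/(2*ε*cos x)) / Ph k x)
      MeasureTheory.volume 0 (π/2) := by
    have := ig.mul_continuousOn (g := fun x => 1 / Ph k x)
      (continuous_const.div (Ph_cont k) (fun x => (hP x).ne')).continuousOn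
    refine this.congr ?_
    intro x _
    simp only; ring
  have hG : ∫ x in (0:ℝ)..(π/2), log (1/(2*ε*cos x)) = π/2 * log (1/ε) := by
    have : ∫ x in (0:ℝ)..(π/2), log (1/(2*ε*cos x)) =
        ∫ x in (0:ℝ)..(π/2), (-log (2*ε) - log (cos x)) := by
      refine (intervalIntegral.integral_congr_ae_restrict hcongr).symm
    have ilc : IntervalIntegrable (fun x => log (cos x)) MeasureTheory.volume 0 (π/2) :=
      intervalIntegrable_log_cos
    rw [this, intervalIntegral.integral_sub (continuous_const.intervalIntegrable _ _) ilc, int_log_cos, intervalIntegral.integral_const,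
      log_mul (by norm_num) hε0.ne', one_div, log_inv]
    simp only [smul_eq_mul]
    ring
  have lo : π/2 * log (1/ε) ≤ J2 k := by
    rw [← hG]
    apply intervalIntegral.integral_mono_on_of_le_Ioo (by positivity) ig iJ
    intro x hx
    rw [le_div_iff₀ (hP x)]
    exact mul_le_of_le_one_right (hnn x hx) (Ph_le k x hk0' hk)
  have up : J2 k ≤ (π/2 * log (1/ε)) * (1 + 2*ε^2) := by
    rw [← hG, ← intervalIntegral.integral_mul_const]
    apply intervalIntegral.integral_mono_on_of_le_Ioo (by positivity) iJ (ig.mul_const _)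
    intro x hx
    rw [div_eq_mul_one_div]
    apply mul_le_mul_of_nonneg_left _ (hnn x hx)
    rw [hε2]
    refine le_trans ?_ (inv_k_le k hk0 hk)
    gcongr
    exact Ph_ge k x hk0' hk
  have hL0 : 0 ≤ log (1/ε) := log_nonneg (by rw [le_div_iff₀ hε0]; linarith)
  have hL1 : ε * log (1/ε) ≤ 1 := by
    have : log (1/ε) ≤ 1/ε := (log_le_sub_one_of_pos (by positivity)).trans (by linarith)
    calc ε * log (1/ε) ≤ ε * (1/ε) := by gcongr
      _ = 1 := by field_simp
  set Λ := log (1/ε)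
  have hJp : 0 < J0 k := lt_of_lt_of_le (by positivity) hJ1
  have hε2Λ : ε^2 * Λ ≤ ε := by nlinarith
  have hpi := pi_pos
  rw [abs_le]
  constructor
  · have : Λ - 2*ε ≤ J2 k / J0 k := by
      rw [le_div_iff₀ hJp]
      rcases le_total (Λ - 2*ε) 0 with h | h
      · have : (Λ - 2*ε) * J0 k ≤ 0 := mul_nonpos_of_nonpos_of_nonneg h hJp.le
        have : 0 ≤ π/2*Λ := by positivity
        linarith
      · calc (Λ - 2*ε) * J0 k ≤ (Λ - 2*ε) * (π/2*(1+2*ε^2)) := by gcongr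
          _ = π/2 * (Λ - 2*ε + 2*(ε^2*Λ) - 4*ε^3) := by ring
          _ ≤ π/2 * Λ := by
            have : 0 ≤ ε^3 := by positivity
            gcongr; linarith
          _ ≤ _ := lo
    linarith
  · have : J2 k / J0 k ≤ Λ + 2*ε := by
      rw [div_le_iff₀ hJp]
      calc J2 k ≤ π/2 * (Λ + 2*(ε^2*Λ)) := by linarith
        _ ≤ π/2 * (Λ + 2*ε) := by gcongr
        _ = (Λ + 2*ε) * (π/2) := by ring
        _ ≤ _ := by gcongr
    linarith

lemma Bg_bd (c d v : ℝ) (hd : 0 < d) (hdc : d < c) (hk0 : 1/2 ≤ d/c) (hv : v ≤ 1)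
    (hmv : 1 - (d/c)^2 ≤ v) (hmu : |mu2 c d / c^2 - 1/3| ≤ v) :
    |Bg c d - 4*π*c^3*(1-(d/c)^2)| ≤ 288*c^3*((1-(d/c)^2)*v) := by
  have hc : 0 < c := hd.trans hdc
  have hk : d/c < 1 := (div_lt_one hc).2 hdc
  have hk0' : 0 < d/c := by linarith
  rw [Bg_eq c d hd hdc]
  set k := d/c
  set μ := mu2 c d / c^2
  have h2 : 0 < 1 - k^2 := by nlinarith
  have hP : ∀ x, 0 < Ph k x := fun x => hk0'.trans_le (Ph_ge k x hk0' hk)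
  have i1 : IntervalIntegrable (fun x => (Ph k x - μ / Ph k x) * sin x^2)
      MeasureTheory.volume 0 (π/2) :=
    Continuous.intervalIntegrable (((Ph_cont k).sub
      (continuous_const.div (Ph_cont k) (fun x => (hP x).ne'))).mul (by fun_prop)) _ _
  have i2 : IntervalIntegrable (fun x => 2/3 * sin x^2) MeasureTheory.volume 0 (π/2) :=
    Continuous.intervalIntegrable (by fun_prop) _ _
  have hs : ∫ x in (0:ℝ)..(π/2), 2/3 * sin x^2 = π/6 := by
    rw [intervalIntegral.integral_const_mul, integral_sin_sq]
    simp
    ring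
  have hb : |(∫ x in (0:ℝ)..(π/2), (Ph k x - μ / Ph k x) * sin x^2) - π/6| ≤ 6*v*(π/2) := by
    rw [← hs, ← intervalIntegral.integral_sub i1 i2]
    have := intervalIntegral.norm_integral_le_of_norm_le_const (a := 0) (b := π/2) (C := 6*v)
      (f := fun x => (Ph k x - μ / Ph k x) * sin x^2 - 2/3*sin x^2) ?_
    · rwa [sub_zero, abs_of_pos (by positivity), norm_eq_abs] at this
    · intro x _
      rw [← sub_mul, norm_eq_abs, abs_mul, abs_of_nonneg (sq_nonneg (sin x))]
      have hp1 := Ph_ge k x hk0' hk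
      have hp2 := Ph_le k x hk0' hk
      have hp := hP x
      have hi : 1 / Ph k x ≤ 1 + 2*v := by
        refine le_trans ?_ ((inv_k_le k hk0 hk).trans (by linarith))
        gcongr
      have hi1 : 1 ≤ 1 / Ph k x := by rw [le_div_iff₀ hp]; linarith
      have h1k : 1 - k ≤ v := by nlinarith
      have : |Ph k x - μ / Ph k x - 2/3| ≤ 6*v := by
        rw [div_eq_mul_one_div μ]
        generalize 1 / Ph k x = q at *
        rw [abs_le] at hmu ⊢
        have hμ1 : μ * (q - 1) ≤ 2 * (2*v) := by nlinarith
        have hμ2 : -(2 * (2*v)) ≤ μ * (q - 1) := by nlinarith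
        constructor <;> nlinarith
      calc _ ≤ 6*v*1 := by
            gcongr
            · linarith
            · exact sin_sq_le_one x
        _ = _ := by ring
  set X := ∫ x in (0:ℝ)..(π/2), (Ph k x - μ / Ph k x) * sin x^2
  have : 24*c^3*(1-k^2)*X - 4*π*c^3*(1-k^2) = (24*c^3*(1-k^2)) * (X - π/6) := by ring
  rw [this, abs_mul, abs_of_pos (by positivity)]
  have hv0 : 0 < v := by linarith
  calc _ ≤ (24*c^3*(1-k^2)) * (6*v*(π/2)) := by gcongr
    _ ≤ (24*c^3*(1-k^2)) * (6*v*(4/2)) := by gcongr; exact pi_le_four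
    _ = _ := by ring

lemma abs_log_le (x : ℝ) (hx : 1/2 ≤ x) : |log x| ≤ 2 * |x - 1| := by
  have hx0 : 0 < x := by linarith
  have h1 := log_le_sub_one_of_pos hx0
  have h2 := one_sub_inv_le_log_of_pos hx0
  have h3 : 1 - x⁻¹ = (x-1)/x := by field_simp
  rw [abs_le]
  rcases le_total 0 (x-1) with h | h
  · rw [abs_of_nonneg h]
    have : 0 ≤ (x-1)/x := by positivity
    constructor <;> linarith
  · rw [abs_of_nonpos h]
    have : 2*(x-1) ≤ (x-1)/x := by
      rw [le_div_iff₀ hx0]; nlinarith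
    constructor <;> linarith

lemma asymQ (m K E L Q : ℝ) (hm : 0 < m)
    (h100 : 100 ≤ L) (hεL : √m * L^2 ≤ 1)
    (hK : |K - L| ≤ 8 * √m) (hE : |E - 1| ≤ 2 * √m)
    (hQ : Q * (E - m*K) = K - E + 3/2 * (E - m*K)) : |Q - (L + 1/2)| ≤ 10/L := by
  have hε := sqrt_pos.2 hm
  have hε2 := sq_sqrt hm.le
  set ε := √m
  rw [← hε2] at hQ
  have a1 : ε * L ≤ 1/100 := by nlinarith [mul_pos hε (by linarith : 0 < L)]
  have a0 : ε ≤ 1/10000 := by nlinarith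
  rw [abs_le] at hK hE
  have b1 : ε^2*K ≤ ε := by nlinarith [mul_pos hε hε]
  have b2 : 0 ≤ ε^2*K := by
    have : 0 ≤ K := by linarith
    positivity
  have hD : |E - ε^2*K - 1| ≤ 3*ε := by rw [abs_le]; constructor <;> linarith
  set D := E - ε^2*K with hDdef
  have hD' := abs_le.1 hD
  have hDp : 1/2 ≤ D := by linarith
  have key : (Q - (L+1/2)) * D = (K-L) - (E-1) + (1 - L) * (D-1) := by
    have : (Q - (L+1/2)) * D = Q * D - (L+1/2) * D := by ring
    rw [this, hQ]; ring
  have hl : |(Q - (L+1/2)) * D| ≤ 5 * (ε*L) := by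
    rw [key, abs_le]
    have c1 : |(1-L)*(D-1)| ≤ L * (3*ε) := by
      rw [abs_mul]
      gcongr
      · rw [abs_le]; constructor <;> linarith
    rw [abs_le] at c1
    have : 100 * ε ≤ ε * L := by nlinarith
    constructor <;> nlinarith
  rw [abs_mul, abs_of_pos (by linarith : 0 < D)] at hl
  have hLp : 0 < L := by linarith
  rw [le_div_iff₀ hLp]
  have h3 : |Q - (L+1/2)| ≤ 10 * (ε*L) := by nlinarith [abs_nonneg (Q - (L+1/2))]
  nlinarith

lemma asym_l (m v L Q l : ℝ) (hm : 0 < m) (hL : L = log (4/√m)) (hv : v = m * Q)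
    (h100 : 100 ≤ L) (h2L : 2 ≤ log L) (h6L : log L ≤ L/12)
    (hl : l = log (1/v)) (hQ : |Q - (L + 1/2)| ≤ 10/L) :
    |l - 2*L| ≤ 3 * log L ∧ |log Q - log (l/2)| ≤ 4 * log L / L ∧
    |L - Q + Q/l| ≤ 7 * log L / L := by
  have hLp : 0 < L := by linarith
  have hε := sqrt_pos.2 hm
  have hε2 := sq_sqrt hm.le
  have t1 : 10/L ≤ 1/10 := by rw [div_le_iff₀ hLp]; linarith
  have hQ' := abs_le.1 hQ
  have hQp : 0 < Q := by linarith
  have hlogm : log m = 4 * log 2 - 2 * L := by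
    have h1 : log m = 2 * log (√m) := by rw [← log_rpow hε]; norm_cast; rw [hε2]
    have h2 : L = 2 * log 2 - log (√m) := by
      rw [hL, log_div (by norm_num) hε.ne', show (4:ℝ) = 2^2 by norm_num, log_pow]; norm_num
    rw [h1, h2]; ring
  have hl' : l = 2*L - 4 * log 2 - log Q := by
    rw [hl, one_div, log_inv, hv, log_mul hm.ne' hQp.ne', hlogm]; ring
  have P2 : |log Q - log L| ≤ 2/L := by
    rw [← log_div hQp.ne' hLp.ne']
    refine (abs_log_le _ ?_).trans ?_
    · rw [le_div_iff₀ hLp]; linarith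
    · have : Q/L - 1 = (Q - L)/L := by field_simp
      rw [this, abs_div, abs_of_pos hLp, ← mul_div_assoc]
      gcongr
      have : |Q - L| ≤ 1 := by rw [abs_le]; constructor <;> linarith
      linarith
  have t2 : 2/L ≤ 1/50 := by rw [div_le_iff₀ hLp]; linarith
  have P2' := abs_le.1 P2
  have hlog2 := log_two_lt_d9
  have hlog2' := log_two_gt_d9
  have P3 : |l - 2*L| ≤ 3 * log L := by
    rw [hl', abs_le]; constructor <;> linarith
  have P3' := abs_le.1 P3
  have hlp : 0 < l := by linarith
  have P3b : |log (l/2) - log L| ≤ 3 * log L / L := by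
    rw [← log_div (by positivity) hLp.ne']
    refine (abs_log_le _ ?_).trans ?_
    · rw [le_div_iff₀ hLp]; linarith
    · have : l/2/L - 1 = (l - 2*L)/(2*L) := by field_simp
      rw [this, abs_div, abs_of_pos (by positivity : 0 < 2*L), ← mul_div_assoc,
        div_le_div_iff₀ (by positivity) hLp]
      nlinarith
  have e1 : 2/L ≤ log L / L := by gcongr
  refine ⟨P3, ?_, ?_⟩
  · have : log Q - log (l/2) = (log Q - log L) - (log (l/2) - log L) := by ring
    rw [this]
    refine (abs_sub _ _).trans ?_
    have : 4 * log L / L = log L / L + 3 * log L / L := by ring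
    linarith
  · have : L - Q + Q/l = -(Q - (L+1/2)) + (2*Q - l)/(2*l) := by field_simp; ring
    rw [this]
    refine (abs_add_le _ _).trans ?_
    rw [abs_neg, abs_div, abs_of_pos (by positivity : 0 < 2*l)]
    have h1 : |2*Q - l| / (2*l) ≤ 2 * log L / L := by
      rw [div_le_div_iff₀ (by positivity) hLp]
      have : |2*Q - l| ≤ 4 * log L := by rw [abs_le]; constructor <;> linarith
      nlinarith
    have h2 : 10/L ≤ 5 * log L / L := by gcongr; linarith
    have : 7 * log L / L = 5 * log L / L + 2 * log L / L := by ring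
    linarith

set_option maxHeartbeats 2000000 in
lemma asym_main (c N A t v m K E J b R L Q l : ℝ) (hc : 0 < c) (hN : 1 ≤ N) (hA : 0 < A)
    (ht : 0 < t) (hm : 0 < m) (hL : L = log (4/√m)) (hv : v = m * Q)
    (h100 : 100 ≤ L) (h2L : 2 ≤ log L) (h6L : log L ≤ L/12) (hεL : √m * L^2 ≤ 1)
    (hl : l = log (1/v))
    (hK : |K - L| ≤ 8 * √m) (hE : |E - 1| ≤ 2 * √m)
    (hQ : Q * (E - m*K) = K - E + 3/2 * (E - m*K))
    (hJ1 : π/2 ≤ J) (hJ2 : J ≤ π/2 * (1 + 2*m))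
    (hR : |R - log (1/√m)| ≤ 2 * √m)
    (hb : |b - 4*π*c^3*m| ≤ 288*c^3*(m*v))
    (htv : t * v ≤ A * l) :
    |(-8*c^3*(t*v) + (2*N-1/2) * log t + t * b * (K/J) - R - (2*N-1)*(π*(K/J)))
      - (-(2*N-1/2) * log (l/(v*t)) - 8*c^3*t*v/l - (6*N-7/2) * log 2)|
      ≤ (3*(6000 * A * c^3 + 2 + 48*(2*N-1) + 4*(2*N-1/2))) * log l ^ 2 / l ∧
    0 < l ∧ 1 ≤ log l := by
  have hLp : 0 < L := by linarith
  have q := asymQ m K E L Q hm h100 hεL hK hE hQ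
  obtain ⟨p1, p2, p3⟩ := asym_l m v L Q l hm hL hv h100 h2L h6L hl q
  have hε := sqrt_pos.2 hm
  have hε2 := sq_sqrt hm.le
  have t1 : 10/L ≤ 1/10 := by rw [div_le_iff₀ hLp]; linarith
  have q' := abs_le.1 q
  have p1' := abs_le.1 p1
  have hQp : 0 < Q := by linarith
  have hlp : 0 < l := by linarith
  have hvp : 0 < v := by rw [hv]; positivity
  have hlogε : log (1/√m) = L - 2 * log 2 := by
    rw [hL, log_div (by norm_num) hε.ne', log_div (by norm_num) hε.ne',
      show (4:ℝ) = 2^2 by norm_num, log_pow]; norm_num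
  have hlogm : log m = 4 * log 2 - 2 * L := by
    have h1 : log m = 2 * log (√m) := by rw [← log_rpow hε]; norm_cast; rw [hε2]
    have h2 : L = 2 * log 2 - log (√m) := by
      rw [hL, log_div (by norm_num) hε.ne', show (4:ℝ) = 2^2 by norm_num, log_pow]; norm_num
    rw [h1, h2]; ring
  set ε := √m with hεdef
  have a1 : ε * L ≤ 1/L := by
    rw [le_div_iff₀ hLp]
    calc ε * L * L = ε * L^2 := by ring
      _ ≤ 1 := hεL
  have a1' : 1/L ≤ 1/100 := by gcongr
  have a0 : ε ≤ 1/L := by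
    have : ε * 1 ≤ ε * L := by gcongr; linarith
    linarith
  have aL : 1/L ≤ log L / L := by gcongr; linarith
  have amL : m * L ≤ ε := by
    calc m * L = ε * (ε * L) := by rw [← hε2]; ring
      _ ≤ ε * 1 := by gcongr; linarith
      _ = ε := by ring
  set r := log L / L with hr
  have hr0 : 0 ≤ r := by positivity
  -- K/J
  have hpi3 := pi_gt_three
  have hpi4 := pi_le_four
  have hJp : 0 < J := by linarith
  have P7 : |K/J - 2*L/π| ≤ 12 * ε := by
    have : K/J - 2*L/π = ((K-L) - (2*L/π) * (J - π/2))/J := by field_simp; ring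
    rw [this, abs_div, abs_of_pos hJp, div_le_iff₀ hJp]
    refine (abs_sub _ _).trans ?_
    rw [abs_mul, abs_of_pos (by positivity : 0 < 2*L/π), abs_of_nonneg (by linarith : 0 ≤ J - π/2)]
    have : 2*L/π * (J-π/2) ≤ 2*L/π * (π*m) := by gcongr; linarith
    have h2 : 2*L/π * (π*m) = 2*(m*L) := by field_simp
    have h3 : 12*ε*1 ≤ 12*ε*J := by gcongr; linarith
    linarith
  have hKJ : |K/J| ≤ 2*L := by
    have h7 := abs_le.1 P7
    have : 2*L/π ≤ L := by rw [div_le_iff₀ pi_pos]; nlinarith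
    have : 0 ≤ 2*L/π := by positivity
    rw [abs_le]; constructor <;> linarith
  have hvL : v * L ≤ 2 * (1/L) := by
    rw [hv]
    have : Q ≤ 2*L := by linarith
    calc m * Q * L ≤ m * (2*L) * L := by gcongr
      _ = 2 * ((ε*L)*(ε*L)) := by rw [← hε2]; ring
      _ ≤ 2 * ((1/L)*1) := by gcongr; linarith
      _ = _ := by ring
  have P8 : |b*(K/J) - 8*c^3*m*L| ≤ c^3*m*(1400*r) := by
    have : b*(K/J) - 8*c^3*m*L = (b-4*π*c^3*m)*(K/J) + 4*π*c^3*m*(K/J - 2*L/π) := by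
      field_simp; ring
    rw [this]
    refine (abs_add_le _ _).trans ?_
    rw [abs_mul, abs_mul, abs_of_pos (by positivity : 0 < 4*π*c^3*m)]
    have h1 : |b-4*π*c^3*m| * |K/J| ≤ 288*c^3*(m*v) * (2*L) := by gcongr
    have h2 : 4*π*c^3*m * |K/J - 2*L/π| ≤ 4*4*c^3*m*(12*ε) := by gcongr
    have h3 : 288*c^3*(m*v) * (2*L) = c^3*m*(576*(v*L)) := by ring
    have h4 : 4*4*c^3*m*(12*ε) = c^3*m*(192*ε) := by ring
    have h5 : c^3*m*(576*(v*L)) + c^3*m*(192*ε) ≤ c^3*m*(1400*r) := by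
      rw [← mul_add]
      gcongr
      linarith
    linarith
  have htm : t * m ≤ 4 * A := by
    have : t * v = t * m * Q := by rw [hv]; ring
    rw [this] at htv
    have : A * l ≤ 4*A*Q := by
      calc A * l ≤ A * (4*Q) := by gcongr; linarith
        _ = _ := by ring
    have : t*m*Q ≤ 4*A*Q := by linarith
    exact le_of_mul_le_mul_right this hQp
  have B1 : |t*b*(K/J) - 8*c^3*(t*v) + 8*c^3*t*v/l| ≤ 6000*A*c^3*r := by
    have : t*b*(K/J) - 8*c^3*(t*v) + 8*c^3*t*v/l =
      t*(b*(K/J) - 8*c^3*m*L) + 8*c^3*(t*m)*(L-Q+Q/l) := by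
      rw [hv]; field_simp; ring
    rw [this]
    refine (abs_add_le _ _).trans ?_
    rw [abs_mul, abs_mul, abs_of_pos ht, abs_of_pos (by positivity : 0 < 8*c^3*(t*m))]
    have h1 : t*|b*(K/J) - 8*c^3*m*L| ≤ t*(c^3*m*(1400*r)) := by gcongr
    have h2 : t*(c^3*m*(1400*r)) = (t*m)*(c^3*(1400*r)) := by ring
    have h3 : (t*m)*(c^3*(1400*r)) ≤ (4*A)*(c^3*(1400*r)) := by gcongr
    have h4 : 8*c^3*(t*m)*|L-Q+Q/l| ≤ 8*c^3*(4*A)*(7*r) := by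
      gcongr
      calc _ ≤ _ := p3
        _ = _ := by rw [hr]; ring
    have h5 : 0 ≤ A*c^3*r := by positivity
    have h6 : (4*A)*(c^3*(1400*r)) = 5600*(A*c^3*r) := by ring
    have h7 : 8*c^3*(4*A)*(7*r) = 224*(A*c^3*r) := by ring
    have h8 : 6000*A*c^3*r = 6000*(A*c^3*r) := by ring
    linarith
  have B3 : |π*(K/J) - 2*L| ≤ 48*r := by
    have : π*(K/J) - 2*L = π*(K/J - 2*L/π) := by field_simp
    rw [this, abs_mul, abs_of_pos pi_pos]
    calc _ ≤ 4*(12*ε) := by gcongr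
      _ ≤ _ := by linarith
  have hlog : log (l/(v*t)) = log (l/2) + log 2 - log m - log Q - log t := by
    rw [log_div hlp.ne' (by positivity), log_mul hvp.ne' ht.ne', hv, log_mul hm.ne' hQp.ne',
      log_div hlp.ne' (by norm_num)]
    ring
  have tot : (-8*c^3*(t*v) + (2*N-1/2) * log t + t * b * (K/J) - R - (2*N-1)*(π*(K/J)))
      - (-(2*N-1/2) * log (l/(v*t)) - 8*c^3*t*v/l - (6*N-7/2) * log 2) =
      (t*b*(K/J) - 8*c^3*(t*v) + 8*c^3*t*v/l) - (R - log (1/ε)) - (2*N-1)*(π*(K/J) - 2*L)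
       - (2*N-1/2)*(log Q - log (l/2)) := by
    rw [hlog, hlogε, hlogm]; ring
  have bound : |(-8*c^3*(t*v) + (2*N-1/2) * log t + t * b * (K/J) - R - (2*N-1)*(π*(K/J)))
      - (-(2*N-1/2) * log (l/(v*t)) - 8*c^3*t*v/l - (6*N-7/2) * log 2)| ≤
      (6000 * A * c^3 + 2 + 48*(2*N-1) + 4*(2*N-1/2)) * r := by
    rw [tot]
    refine (abs_sub _ _).trans ?_
    have c1 := abs_sub (t*b*(K/J) - 8*c^3*(t*v) + 8*c^3*t*v/l - (R - log (1/ε)))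
      ((2*N-1)*(π*(K/J) - 2*L))
    have c2 := abs_sub (t*b*(K/J) - 8*c^3*(t*v) + 8*c^3*t*v/l) (R - log (1/ε))
    have c3 : |(2*N-1)*(π*(K/J) - 2*L)| ≤ (2*N-1)*(48*r) := by
      rw [abs_mul, abs_of_pos (by linarith)]
      gcongr
      linarith
    have c4 : |(2*N-1/2)*(log Q - log (l/2))| ≤ (2*N-1/2)*(4*r) := by
      rw [abs_mul, abs_of_pos (by linarith)]
      gcongr
      · linarith
      · calc _ ≤ _ := p2
          _ = _ := by rw [hr]; ring
    linarith
  have hLl : L ≤ l := by linarith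
  have hll : log L ≤ log l := log_le_log hLp hLl
  have hl1 : 1 ≤ log l := by linarith
  refine ⟨bound.trans ?_, hlp, hl1⟩
  have hrl : r ≤ 3 * (log l ^2 / l) := by
    rw [hr, ← mul_div_assoc, div_le_div_iff₀ hLp hlp]
    have : l ≤ 3*L := by linarith
    have : log L ≤ log l ^2 := by
      calc log L ≤ log l * 1 := by linarith
        _ ≤ log l * log l := by gcongr
        _ = _ := by ring
    calc log L * l ≤ log l^2 * (3*L) := by gcongr
      _ = _ := by ring
  have : 0 ≤ 6000 * A * c^3 + 2 + 48*(2*N-1) + 4*(2*N-1/2) := by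
    have : 0 ≤ 6000*A*c^3 := by positivity
    linarith
  calc _ ≤ (6000 * A * c^3 + 2 + 48*(2*N-1) + 4*(2*N-1/2)) * (3 * (log l ^2 / l)) := by gcongr
    _ = _ := by ring

lemma exists_eta : ∃ η > 0, ∀ m : ℝ, 0 < m → m < η →
    100 ≤ log (4/√m) ∧ 2 ≤ log (log (4/√m)) ∧ log (log (4/√m)) ≤ log (4/√m) / 12 ∧
    √m * log (4/√m)^2 ≤ 1 ∧ m ≤ 1/4 := by
  have h0 : Filter.Tendsto (fun m : ℝ => √m) (nhdsWithin 0 (Set.Ioi 0))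
      (nhdsWithin 0 (Set.Ioi 0)) := by
    apply tendsto_nhdsWithin_iff.2 ⟨?_, ?_⟩
    · have := (continuous_sqrt.tendsto 0)
      rw [sqrt_zero] at this
      exact this.mono_left nhdsWithin_le_nhds
    · filter_upwards [self_mem_nhdsWithin] with m hm
      exact sqrt_pos.2 hm
  have h1 : Filter.Tendsto (fun m : ℝ => log (4/√m)) (nhdsWithin 0 (Set.Ioi 0)) Filter.atTop := by
    apply tendsto_log_atTop.comp
    simp only [div_eq_mul_inv]
    exact (tendsto_inv_nhdsGT_zero.comp h0).const_mul_atTop (by norm_num)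
  have e1 : ∀ᶠ L : ℝ in Filter.atTop, 100 ≤ L := Filter.eventually_ge_atTop 100
  have e2 : ∀ᶠ L : ℝ in Filter.atTop, 2 ≤ log L := tendsto_log_atTop.eventually_ge_atTop 2
  have e3 : ∀ᶠ L : ℝ in Filter.atTop, log L ≤ L/12 := by
    have := isLittleO_log_id_atTop.def (show (0:ℝ) < 1/12 by norm_num)
    filter_upwards [this, Filter.eventually_ge_atTop 0] with L hL h0
    simp only [id, norm_eq_abs, abs_of_nonneg h0] at hL
    linarith [le_abs_self (log L)]
  have e4 : ∀ᶠ L : ℝ in Filter.atTop, 4 * (L^2 * exp (-L)) ≤ 1 := by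
    have := (tendsto_pow_mul_exp_neg_atTop_nhds_zero 2).const_mul 4
    rw [mul_zero] at this
    exact this.eventually_le_const (by norm_num)
  have e5 : ∀ᶠ m : ℝ in nhdsWithin 0 (Set.Ioi 0), m ≤ 1/4 :=
    (eventually_le_nhds (by norm_num)).filter_mono nhdsWithin_le_nhds
  have tot := (h1.eventually (e1.and (e2.and (e3.and e4)))).and e5
  obtain ⟨η, hη, hsub⟩ := (mem_nhdsGT_iff_exists_Ioo_subset).1 tot
  refine ⟨η, hη, fun m hm hmη => ?_⟩
  obtain ⟨⟨a1, a2, a3, a4⟩, a5⟩ := hsub ⟨hm, hmη⟩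
  refine ⟨a1, a2, a3, ?_, a5⟩
  have hε := sqrt_pos.2 hm
  have : exp (-log (4/√m)) = √m/4 := by
    rw [exp_neg, exp_log (by positivity), inv_div]
  rw [this] at a4
  linarith

lemma exists_T (a g η : ℝ) (ha : 0 < a) (hη : 0 < η) :
    ∃ T > 0, ∀ t : ℝ, T < t → 1 ≤ t ∧ 1 ≤ a * log t ∧ g * log t ≤ √t ∧ g * log t / t < η := by
  have e0 : ∀ᶠ t : ℝ in Filter.atTop, 1 ≤ t := Filter.eventually_ge_atTop 1
  have e1 : ∀ᶠ t : ℝ in Filter.atTop, 1 ≤ a * log t :=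
    (tendsto_log_atTop.const_mul_atTop ha).eventually_ge_atTop 1
  have l2 : Filter.Tendsto (fun t : ℝ => g * (log t / t^(1/2:ℝ))) Filter.atTop (nhds 0) := by
    have := ((isLittleO_log_rpow_atTop (show (0:ℝ) < 1/2 by norm_num)).tendsto_div_nhds_zero).const_mul g
    simpa using this
  have l3 : Filter.Tendsto (fun t : ℝ => g * (log t / t)) Filter.atTop (nhds 0) := by
    have := (isLittleO_log_id_atTop.tendsto_div_nhds_zero).const_mul g
    simpa using this
  have e2 := l2.eventually_le_const (show (0:ℝ) < 1 by norm_num)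
  have e3 := l3.eventually_lt_const hη
  obtain ⟨T, hT⟩ := Filter.eventually_atTop.1 (e0.and (e1.and (e2.and e3)))
  refine ⟨max T 1, by positivity, fun t ht => ?_⟩
  obtain ⟨a1, a2, a3, a4⟩ := hT t ((le_max_left _ _).trans ht.le)
  refine ⟨a1, a2, ?_, ?_⟩
  · rw [← sqrt_eq_rpow, ← mul_div_assoc, div_le_iff₀ (by positivity), one_mul] at a3
    exact a3
  · rwa [mul_div_assoc]

lemma alphan_eq (c : ℝ) (hc : 0 < c) (f : ℝ → ℝ) (n : ℕ) (x t v d : ℝ) (ht : 0 < t)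
    (hd : 0 < d) (hdc : d < c) (hf : f (x/(12*t)) = d) (hv : v = 1 - x/(4*c^2*t))
    (hK : 0 < KK (d/c)) (hJ : 0 < J0 (d/c)) :
    alphan c f n x t = -8*c^3*(t*v) + (2*n-1/2) * log t +
      t * Bg c d * (KK (d/c)/J0 (d/c)) - J2 (d/c)/J0 (d/c)
        - (2*n-1)*(π*(KK (d/c)/J0 (d/c))) := by
  unfold alphan tauStar zvar Delta
  rw [hf, I1_eq c d hd hdc, I0_eq c d hd hdc, I2_eq c d hd hdc]
  have hx : x = 4*c^2*t*(1-v) := by rw [hv]; field_simp; ring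
  rw [hx]
  have := pi_pos
  field_simp
  ring

set_option maxHeartbeats 4000000 in
theorem stmt16 (c : ℝ) (hc : 0 < c) (f : ℝ → ℝ)
    (hmap : ∀ ξ ∈ Set.Icc (-c^2/2) (c^2/3), f ξ ∈ Set.Icc 0 c)
    (hcont : ContinuousOn f (Set.Icc (-c^2/2) (c^2/3)))
    (hmono : StrictMonoOn f (Set.Icc (-c^2/2) (c^2/3)))
    (hmod : ∀ ξ ∈ Set.Icc (-c^2/2) (c^2/3),
      c^2/2 + ξ = mu2 c (f ξ) + (f ξ)^2/2)
    (n : ℕ) (hn : 1 ≤ n) (δ γ : ℝ) (hδ : 0 < δ) (hδγ : δ < γ) :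
    ∃ C > 0, ∃ M : ℝ, ∃ T > 0, ∀ t : ℝ, T < t → ∀ x : ℝ,
      4*c^2*t - γ * Real.log t < x → x < 4*c^2*t - δ * Real.log t →
      (|alphan c f n x t -
          (-(2*n - 1/2) * Real.log (Real.log (1/(1 - x/(4*c^2*t))) / ((1 - x/(4*c^2*t)) * t))
            - 8*c^3*t*(1 - x/(4*c^2*t)) / Real.log (1/(1 - x/(4*c^2*t)))
            - (6*n - 7/2) * Real.log 2)|
        ≤ C * (Real.log (Real.log (1/(1 - x/(4*c^2*t)))))^2
            / Real.log (1/(1 - x/(4*c^2*t)))) ∧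
      |alphan c f n x t| ≤ M := by
  obtain ⟨η, hη, Hη⟩ := exists_eta
  obtain ⟨T, hT, HT⟩ := exists_T (δ/(4*c^2)) (γ/(4*c^2)) (min η 1) (by positivity)
    (lt_min hη one_pos)
  have hγ : 0 < γ := hδ.trans hδγ
  have hN : (1:ℝ) ≤ n := by exact_mod_cast hn
  set A := 2 * (γ/(4*c^2)) with hAdef
  have hA : 0 < A := by positivity
  set a := δ/(4*c^2) with hadef
  have ha : 0 < a := by positivity
  set C := 3*(6000 * A * c^3 + 2 + 48*(2*(n:ℝ)-1) + 4*(2*(n:ℝ)-1/2)) with hCdef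
  have hC : 0 < C := by
    have : 0 < 6000 * A * c^3 := by positivity
    rw [hCdef]; linarith
  refine ⟨C, hC, 4*C + ((2*(n:ℝ)-1/2) * (|log (1/A)| + |log (1/a)|) + 8*c^3*A
    + 6*(n:ℝ)*log 2), T, hT, ?_⟩
  intro t htT x hx1 hx2
  obtain ⟨ht1, hat, hgt, hgη⟩ := HT t htT
  have ht : 0 < t := by linarith
  set v := 1 - x/(4*c^2*t) with hvdef
  have hxv : x = 4*c^2*t*(1-v) := by rw [hvdef]; field_simp; ring
  have hvt1 : a * log t < t * v := by
    rw [hadef, div_mul_eq_mul_div, div_lt_iff₀ (by positivity)]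
    rw [hxv] at hx2; linarith
  have hvt2 : t * v < γ/(4*c^2) * log t := by
    rw [div_mul_eq_mul_div, lt_div_iff₀ (by positivity)]
    rw [hxv] at hx1; linarith
  have hv0 : 0 < v := by
    by_contra h
    push Not at h
    have : t * v ≤ 0 := mul_nonpos_of_nonneg_of_nonpos ht.le h
    linarith
  have hvη : v < min η 1 := by
    refine lt_trans ?_ hgη
    rw [lt_div_iff₀ ht]; linarith
  have hv1 : v < 1 := hvη.trans_le (min_le_right _ _)
  set l := log (1/v) with hl
  have hlt : l = log t - log (t*v) := by
    rw [hl, log_mul ht.ne' hv0.ne', one_div, log_inv]; ring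
  have hl1 : l ≤ log t := by
    have := log_nonneg (show 1 ≤ t*v by linarith)
    linarith
  have hl2 : log t ≤ 2 * l := by
    have h1 : log (t*v) ≤ log (√t) := log_le_log (by positivity) (by linarith)
    rw [log_sqrt ht.le] at h1
    linarith
  have htvA : t * v ≤ A * l := by
    refine hvt2.le.trans ?_
    calc γ/(4*c^2) * log t ≤ γ/(4*c^2) * (2*l) := by gcongr
      _ = _ := by rw [hAdef]; ring
  have htva : a * l ≤ t * v := by
    refine le_trans ?_ hvt1.le
    gcongr
  have hξ : x/(12*t) = c^2/3*(1-v) := by rw [hxv]; field_simp; ring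
  have hc2 : 0 < c^2 := by positivity
  have hmem : x/(12*t) ∈ Set.Icc (-c^2/2) (c^2/3) := by
    rw [hξ]; constructor <;> nlinarith
  have hml : (-c^2/2) ∈ Set.Icc (-c^2/2) (c^2/3) := ⟨le_refl _, by linarith⟩
  have hmr : (c^2/3) ∈ Set.Icc (-c^2/2) (c^2/3) := ⟨by linarith, le_refl _⟩
  have hd0 : 0 < f (x/(12*t)) :=
    (hmap _ hml).1.trans_lt (hmono hml hmem (by rw [hξ]; nlinarith))
  have hdc : f (x/(12*t)) < c :=
    (hmono hmem hmr (by rw [hξ]; nlinarith)).trans_le (hmap _ hmr).2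
  have hmd := hmod _ hmem
  obtain ⟨d, hd⟩ : ∃ d, f (x/(12*t)) = d := ⟨_, rfl⟩
  rw [hd] at hd0 hdc hmd
  rw [hξ] at hmd
  have hk0 : 0 < d/c := by positivity
  have hk1 : d/c < 1 := (div_lt_one hc).2 hdc
  obtain ⟨hD, hmu⟩ := mu2_eq c d hd0 hdc
  have hKE := KK_sub_EE_nonneg (d/c) hk0 hk1
  have hm : 0 < 1 - (d/c)^2 := by nlinarith
  have hdm : d^2 = c^2 * (1 - (1 - (d/c)^2)) := by field_simp; ring
  rw [hdm] at hmd
  have hBg := Bg_bd c d v hd0 hdc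
  have hKb := KK_bd (d/c)
  have hEb := EE_bd (d/c) hk0 hk1
  have hJb := J0_bd (d/c)
  have hJ2b := J2_bd (d/c)
  have hal := alphan_eq c hc f n x t v d ht hd0 hdc hd hvdef
  have hkm : (1 - (d/c)^2) ≤ 1/4 → 1/2 ≤ d/c := by intro h; nlinarith
  have hμ : mu2 c d = c^2 * (1/3 - v/3 + (1 - (d/c)^2)/2) := by linarith
  generalize 1 - (d/c)^2 = m at *
  generalize KK (d/c) = K at *
  generalize EE (d/c) = E at *
  rw [hμ] at hmu
  have hrel : v * (E - m*K) = m * (K - E + 3/2 * (E - m*K)) := by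
    have : c^2 * (v * (E - m*K)) = c^2 * (m * (K - E + 3/2 * (E - m*K))) := by linarith
    exact mul_left_cancel₀ hc2.ne' this
  have hmv : m ≤ v := by
    have h1 : 0 ≤ m * (K - E) := by positivity
    have h2 : m * (E - m*K) ≤ v * (E - m*K) := by
      have : 0 ≤ m * (E - m*K) := by positivity
      linarith
    exact le_of_mul_le_mul_right h2 hD
  obtain ⟨b1, b2, b3, b4, b5⟩ := Hη m hm (hmv.trans_lt (hvη.trans_le (min_le_left _ _)))
  have hk2 := hkm b5
  have hsm : √m ≤ 1/2 := by
    rw [sqrt_le_iff]; constructor <;> linarith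
  have hKb' := hKb hk2 hk1
  obtain ⟨hJ1, hJ2⟩ := hJb hk2 hk1
  have hJp : 0 < J0 (d/c) := lt_of_lt_of_le (by positivity) hJ1
  have hKp : 0 < K := by
    have := abs_le.1 hKb'
    linarith
  have hBg' := hBg hk2 hv1.le hmv (by
    rw [hμ, mul_div_cancel_left₀ _ hc2.ne', abs_le]
    constructor <;> linarith)
  obtain ⟨r1, r2, r3⟩ := asym_main c n A t v m K E (J0 (d/c)) (Bg c d) (J2 (d/c)/J0 (d/c))
    (log (4/√m)) (v/m) l hc hN hA ht hm rfl (by field_simp) b1 b2 b3 b4 hl hKb' hEb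
    (by rw [div_mul_eq_mul_div, hrel]; field_simp) hJ1 hJ2 (hJ2b hk2 hk1 hsm) hBg' htvA
  rw [← hal hKp hJp, ← hCdef] at r1
  refine ⟨r1, ?_⟩
  have hlog4 : log l ^ 2 ≤ 4 * l := by
    have h1 : log (√l) ≤ √l := (log_le_sub_one_of_pos (sqrt_pos.2 r2)).trans (by linarith)
    rw [log_sqrt r2.le] at h1
    have h2 : log l ≤ 2 * √l := by linarith
    calc log l ^2 ≤ (2*√l)^2 := by gcongr
      _ = _ := by rw [mul_pow, sq_sqrt r2.le]; norm_num
  have hr4 : C * log l ^2 / l ≤ 4 * C := by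
    rw [div_le_iff₀ r2]
    calc C * log l^2 ≤ C * (4*l) := by gcongr
      _ = _ := by ring
  have hvtp : 0 < v * t := by positivity
  have hlogb : |log (l/(v*t))| ≤ |log (1/A)| + |log (1/a)| := by
    have h1 : log (1/A) ≤ log (l/(v*t)) := by
      apply log_le_log (by positivity)
      rw [div_le_div_iff₀ hA hvtp]; linarith
    have h2 : log (l/(v*t)) ≤ log (1/a) := by
      apply log_le_log (by positivity)
      rw [div_le_div_iff₀ hvtp ha]; linarith
    have := neg_abs_le (log (1/A))
    have := le_abs_self (log (1/a))
    have := abs_nonneg (log (1/A))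
    have := abs_nonneg (log (1/a))
    rw [abs_le]; constructor <;> linarith
  have hq : |8*c^3*t*v/l| ≤ 8*c^3*A := by
    rw [abs_of_pos (by positivity), div_le_iff₀ r2]
    calc 8*c^3*t*v = 8*c^3*(t*v) := by ring
      _ ≤ 8*c^3*(A*l) := by gcongr
      _ = _ := by ring
  have hlog2 : 0 < log 2 := log_pos (by norm_num)
  have h3 : |(6*(n:ℝ)-7/2)*log 2| ≤ 6*(n:ℝ)*log 2 := by
    rw [abs_mul, abs_of_pos hlog2]
    gcongr
    rw [abs_le]; constructor <;> linarith
  have h4 : |(2*(n:ℝ)-1/2) * log (l/(v*t))| ≤ (2*(n:ℝ)-1/2) * (|log (1/A)| + |log (1/a)|) := by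
    rw [abs_mul, abs_of_pos (by linarith)]
    gcongr
    linarith
  have r1' := abs_le.1 (r1.trans hr4)
  rw [abs_le] at hq h3 h4 ⊢
  constructor <;> linarith
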